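/- Let n ≥ 2, R ∈ ℕ, Ω = (R,∞) × ℝ^{n-1}, w: ℝ → (0,∞) smooth, bounded, with C⁻¹ ≤ w(r)/w(r′) ≤ C for |r−r′| ≤ 1, and ν = w(r)^{1−n} dr dθ. For k ∈ ℤ, i ∈ ℕ ∩ [2^{k₊}R, ∞), m ∈ ℤ^{n-1} (k₊ = max(0,k)) let P_{(i,m)}(k) = 2^{−k₊}(i, i+1] × 2^{−k} w([2^{−k₊} i]) C_m, where C_m = [m₁,m₁+1) × ⋯ × [m_{n-1},m_{n-1}+1) and [·] is the integer part. Then there exists C₂ ≥ 1, depending only on n and w, such that: if k ≤ 0 then C₂^{−(n−1)} 2^{−k(n−1)} ≤ ν(P_{(i,m)}(k)) ≤ C₂^{n−1} 2^{−k(n−1)}, and if k ≥ 1 then C₂^{−(n−1)} 2^{−kn} ≤ ν(P_{(i,m)}(k)) ≤ C₂^{n−1} 2^{−kn}. -/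

import Mathlib

open MeasureTheory Set

/-- The dyadic piece `P_{(i,m)}(k) = 2^{-k₊}(i,i+1] × 2^{-k} w([2^{-k₊}i]) C_m`,
where `k₊ = max(k,0)`, `C_m = Π_d [m_d, m_d+1)` and `[·]` is the integer part. -/
noncomputable def dyadicPiece (n : ℕ) (w : ℝ → ℝ) (k : ℤ) (i : ℕ) (m : Fin (n-1) → ℤ) :
    Set (ℝ × EuclideanSpace ℝ (Fin (n-1))) :=
  {x | x.1 ∈ Set.Ioc ((2:ℝ) ^ (-(max k 0)) * i) ((2:ℝ) ^ (-(max k 0)) * (i + 1)) ∧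
    ∀ d, x.2 d ∈ Set.Ico
      ((2:ℝ) ^ (-k) * w ((⌊(2:ℝ) ^ (-(max k 0)) * i⌋ : ℤ)) * m d)
      ((2:ℝ) ^ (-k) * w ((⌊(2:ℝ) ^ (-(max k 0)) * i⌋ : ℤ)) * (m d + 1))}


lemma dyadicPiece_eq (n : ℕ) (w : ℝ → ℝ) (k : ℤ) (i : ℕ) (m : Fin (n-1) → ℤ) :
    dyadicPiece n w k i m =
    Set.Ioc ((2:ℝ) ^ (-(max k 0)) * i) ((2:ℝ) ^ (-(max k 0)) * (i + 1)) ×ˢ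
    ((WithLp.ofLp : EuclideanSpace ℝ (Fin (n-1)) → (Fin (n-1) → ℝ)) ⁻¹'
      (Set.univ.pi fun d => Set.Ico
      ((2:ℝ) ^ (-k) * w ((⌊(2:ℝ) ^ (-(max k 0)) * i⌋ : ℤ)) * m d)
      ((2:ℝ) ^ (-k) * w ((⌊(2:ℝ) ^ (-(max k 0)) * i⌋ : ℤ)) * (m d + 1)))) := by
  ext x
  simp [dyadicPiece, Set.mem_pi]

lemma measurableSet_dyadicPiece (n : ℕ) (w : ℝ → ℝ) (k : ℤ) (i : ℕ) (m : Fin (n-1) → ℤ) :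
    MeasurableSet (dyadicPiece n w k i m) := by
  rw [dyadicPiece_eq]
  refine measurableSet_Ioc.prod ?_
  refine (PiLp.volume_preserving_ofLp (Fin (n-1))).measurable ?_
  exact MeasurableSet.univ_pi fun d => measurableSet_Ico

lemma volume_dyadicPiece (n : ℕ) (w : ℝ → ℝ) (hw : ∀ r, 0 < w r)
    (k : ℤ) (i : ℕ) (m : Fin (n-1) → ℤ) :
    volume (dyadicPiece n w k i m) = ENNReal.ofReal ((2:ℝ) ^ (-(max k 0)) *
      ((2:ℝ) ^ (-k) * w ((⌊(2:ℝ) ^ (-(max k 0)) * i⌋ : ℤ))) ^ (n-1)) := by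
  rw [dyadicPiece_eq, Measure.volume_eq_prod, Measure.prod_prod,
    (PiLp.volume_preserving_ofLp (Fin (n-1))).measure_preimage
      (MeasurableSet.univ_pi fun d => measurableSet_Ico).nullMeasurableSet,
    Real.volume_Ioc, Real.volume_pi_Ico, ENNReal.ofReal_mul (by positivity),
    ENNReal.ofReal_pow (mul_nonneg (by positivity) (hw _).le)]
  congr 2
  · ring
  · rw [Finset.prod_congr rfl (g := fun _ => ENNReal.ofReal
      ((2:ℝ) ^ (-k) * w ((⌊(2:ℝ) ^ (-(max k 0)) * i⌋ : ℤ))))]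
    · simp
    · intro d _
      congr 1
      ring

lemma w_comp_two (w : ℝ → ℝ) (hw : ∀ r, 0 < w r) (C : ℝ) (hC : 1 ≤ C)
    (h : ∀ r r' : ℝ, |r - r'| ≤ 1 → C⁻¹ ≤ w r / w r' ∧ w r / w r' ≤ C)
    (r r' : ℝ) (hr : |r - r'| ≤ 2) : w r ≤ C ^ 2 * w r' := by
  have h1 := (h r ((r + r') / 2) (by rw [abs_le] at *; constructor <;> linarith)).2
  have h2 := (h ((r + r') / 2) r' (by rw [abs_le] at *; constructor <;> linarith)).2
  rw [div_le_iff₀ (hw _)] at h1 h2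
  nlinarith

lemma nu_dyadicPiece (n : ℕ) (hn : 2 ≤ n) (R : ℕ)
    (w : ℝ → ℝ) (hw : ∀ r, 0 < w r) (D : ℝ) (hD : 1 ≤ D)
    (h : ∀ r r' : ℝ, |r - r'| ≤ 2 → w r ≤ D * w r')
    (k : ℤ) (i : ℕ) (m : Fin (n-1) → ℤ) (hi : (2:ℝ) ^ (max k 0) * R ≤ (i : ℝ)) :
    ENNReal.ofReal ((D ^ (n-1))⁻¹ * ((2:ℝ) ^ (-(max k 0)) * ((2:ℝ) ^ (-k)) ^ (n-1))) ≤
    (volume.withDensity fun x : ℝ × EuclideanSpace ℝ (Fin (n-1)) =>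
      ENNReal.ofReal (w x.1 ^ ((1:ℤ) - n))).restrict
        (Ioi (R:ℝ) ×ˢ univ) (dyadicPiece n w k i m) ∧
    (volume.withDensity fun x : ℝ × EuclideanSpace ℝ (Fin (n-1)) =>
      ENNReal.ofReal (w x.1 ^ ((1:ℤ) - n))).restrict
        (Ioi (R:ℝ) ×ˢ univ) (dyadicPiece n w k i m) ≤
    ENNReal.ofReal (D ^ (n-1) * ((2:ℝ) ^ (-(max k 0)) * ((2:ℝ) ^ (-k)) ^ (n-1))) := by
  have hP := measurableSet_dyadicPiece n w k i m
  have hV := volume_dyadicPiece n w hw k i m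
  have hsub : dyadicPiece n w k i m ⊆ Ioi (R:ℝ) ×ˢ univ := by
    intro x hx
    refine ⟨?_, mem_univ _⟩
    refine lt_of_le_of_lt ?_ hx.1.1
    rw [zpow_neg, inv_mul_eq_div, le_div_iff₀ (by positivity)]
    linarith
  have hexp : ((1:ℤ) - n) = -((n-1 : ℕ) : ℤ) := by omega
  have hdist : ∀ x ∈ dyadicPiece n w k i m,
      |x.1 - ((⌊(2:ℝ) ^ (-(max k 0)) * i⌋ : ℤ) : ℝ)| ≤ 2 := by
    intro x hx
    have h1 := hx.1.1
    have h2 := hx.1.2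
    have h3 := Int.floor_le ((2:ℝ) ^ (-(max k 0)) * i)
    have h4 := Int.lt_floor_add_one ((2:ℝ) ^ (-(max k 0)) * i)
    have h5 : (2:ℝ) ^ (-(max k 0)) ≤ 1 :=
      zpow_le_one_of_nonpos₀ (by norm_num) (by simp)
    rw [abs_le]
    constructor <;> linarith
  set W := w ((⌊(2:ℝ) ^ (-(max k 0)) * i⌋ : ℤ) : ℝ) with hW
  have hWp : 0 < W := hw _
  have hD0 : 0 < D := by linarith
  rw [Measure.restrict_apply hP, inter_eq_self_of_subset_left hsub, withDensity_apply _ hP]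
  constructor
  · calc _ = ENNReal.ofReal (((D * W) ^ (n-1))⁻¹) * volume (dyadicPiece n w k i m) := by
          rw [hV, ← ENNReal.ofReal_mul (by positivity)]
          congr 1
          rw [mul_pow, mul_pow]
          field_simp
      _ = ∫⁻ x in dyadicPiece n w k i m, ENNReal.ofReal (((D * W) ^ (n-1))⁻¹) := by
          rw [setLIntegral_const]
      _ ≤ _ := by
          refine setLIntegral_mono' hP fun x hx => ENNReal.ofReal_le_ofReal ?_
          rw [hexp, zpow_neg, zpow_natCast]
          have := hw x.1
          have := h _ _ (hdist x hx)
          gcongr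
  · calc _ ≤ ∫⁻ x in dyadicPiece n w k i m, ENNReal.ofReal (D ^ (n-1) * (W ^ (n-1))⁻¹) := by
          refine setLIntegral_mono' hP fun x hx => ENNReal.ofReal_le_ofReal ?_
          rw [hexp, zpow_neg, zpow_natCast]
          have := hw x.1
          have := h _ _ ((abs_sub_comm _ _).trans_le (hdist x hx))
          rw [← div_eq_mul_inv, le_div_iff₀ (by positivity), inv_mul_le_iff₀ (by positivity),
            mul_comm, ← mul_pow]
          gcongr
      _ = ENNReal.ofReal (D ^ (n-1) * (W ^ (n-1))⁻¹) * volume (dyadicPiece n w k i m) := by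
          rw [setLIntegral_const]
      _ = _ := by
          rw [hV, ← ENNReal.ofReal_mul (by positivity)]
          congr 1
          rw [mul_pow]
          field_simp

/-- **Two-sided bounds for the `ν`-measures of the dyadic pieces:**
`ν(P_{(i,m)}(k)) ≈ 2^{-k(n-1)}` for `k ≤ 0` and `≈ 2^{-kn}` for `k ≥ 1`. -/
theorem dyadic_piece_measure_bounds
    (n : ℕ) (hn : 2 ≤ n) (R : ℕ)
    (w : ℝ → ℝ) (hw_pos : ∀ r, 0 < w r)
    (hw_smooth : ContDiff ℝ (⊤ : ℕ∞) w)
    (hw_bdd : ∃ Cb, ∀ r, w r ≤ Cb)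
    (hw_comp : ∃ C, 1 ≤ C ∧ ∀ r r' : ℝ, |r - r'| ≤ 1 →
      C⁻¹ ≤ w r / w r' ∧ w r / w r' ≤ C)
    (ν : Measure (ℝ × EuclideanSpace ℝ (Fin (n-1))))
    (hν : ν = (volume.withDensity fun x => ENNReal.ofReal (w x.1 ^ ((1:ℤ) - n))).restrict
        (Ioi (R:ℝ) ×ˢ univ)) :
    ∃ C₂ : ℝ, 1 ≤ C₂ ∧
      ∀ (k : ℤ) (i : ℕ) (m : Fin (n-1) → ℤ), (2:ℝ) ^ (max k 0) * R ≤ (i : ℝ) →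
        (k ≤ 0 →
          ENNReal.ofReal (C₂ ^ (-((n:ℤ) - 1)) * (2:ℝ) ^ (-k * ((n:ℤ) - 1))) ≤
              ν (dyadicPiece n w k i m) ∧
            ν (dyadicPiece n w k i m) ≤
              ENNReal.ofReal (C₂ ^ ((n:ℤ) - 1) * (2:ℝ) ^ (-k * ((n:ℤ) - 1)))) ∧
        (1 ≤ k →
          ENNReal.ofReal (C₂ ^ (-((n:ℤ) - 1)) * (2:ℝ) ^ (-k * n)) ≤
              ν (dyadicPiece n w k i m) ∧
            ν (dyadicPiece n w k i m) ≤
              ENNReal.ofReal (C₂ ^ ((n:ℤ) - 1) * (2:ℝ) ^ (-k * n))) := by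
  subst hν
  obtain ⟨C, hC, h⟩ := hw_comp
  refine ⟨C ^ 2, one_le_pow₀ hC, fun k i m hi => ?_⟩
  have key := nu_dyadicPiece n hn R w hw_pos (C ^ 2) (one_le_pow₀ hC)
    (w_comp_two w hw_pos C hC h) k i m hi
  have hexp : ((n:ℤ) - 1) = ((n-1 : ℕ) : ℤ) := by omega
  have e : ((2:ℝ) ^ (-k)) ^ (n-1) = (2:ℝ) ^ (-k * ((n:ℤ) - 1)) := by
    rw [hexp, zpow_mul, zpow_natCast]
  have e1 : (C ^ 2) ^ (n-1) = (C ^ 2) ^ ((n:ℤ) - 1) := by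
    rw [hexp, zpow_natCast]
  rw [e, e1, ← zpow_neg] at key
  constructor
  · intro hk
    rw [max_eq_right hk] at key
    simpa only [neg_zero, zpow_zero, one_mul] using key
  · intro hk
    rw [max_eq_left (by omega), ← zpow_add₀ (by norm_num),
      show -k + -k * ((n:ℤ) - 1) = -k * n by ring] at key
    exact key
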